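/- Let A ⊆ 𝔽₂^m be an affine subspace and let t ∈ ℕ. Then there exists an m-variate polynomial P over 𝔽₂ of total degree at most t such that the number of points x ∈ 𝔽₂^m with P(x) ≠ 𝟙_A(x) is at most 2^(m−t); equivalently, Pr_{x uniform in 𝔽₂^m}[P(x) ≠ 𝟙_A(x)] ≤ 2^(−t). Moreover, P can be taken so that P(x) = 1 for all x ∈ A. -/

import Mathlib

open scoped BigOperators Classical

noncomputable section

/-- A subset of `𝔽₂ᵐ` is an affine subspace if it is a coset of an `𝔽₂`-linear subspace. -/
def IsAffineSubspace {m : ℕ} (A : Set (Fin m → ZMod 2)) : Prop :=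
  ∃ (u : Fin m → ZMod 2) (U₀ : Submodule (ZMod 2) (Fin m → ZMod 2)),
    A = {x | x - u ∈ U₀}

/-- If `f a y ≠ 0` for some `a`, then `f · y` vanishes on exactly half of the group. -/
lemma two_mul_card_apply_eq_zero {W β : Type*} [AddCommGroup W] [Fintype W]
    (f : W →+ (β → ZMod 2)) (y : β) (hy : ∃ a, f a y ≠ 0) :
    2 * (Finset.univ.filter fun a : W => f a y = 0).card = Fintype.card W := by
  obtain ⟨b, hb⟩ := hy
  have h : (Finset.univ.filter fun a : W => f a y = 0).card =
      (Finset.univ.filter fun a : W => ¬ f a y = 0).card := by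
    refine Finset.card_equiv (Equiv.addRight b) fun a => ?_
    simp only [Finset.mem_filter, Finset.mem_univ, true_and, Equiv.coe_addRight, map_add,
      Pi.add_apply]
    generalize f a y = p at *
    generalize f b y = q at *
    revert p q
    decide
  have h' := Finset.card_filter_add_card_filter_not (s := (Finset.univ : Finset W))
    (fun a => f a y = 0)
  rw [Finset.card_univ] at h'
  omega

/-- Some element of the group kills at most half of the points of `B`. -/
lemma exists_two_mul_card_apply_eq_zero_le {W β : Type*} [AddCommGroup W] [Fintype W]
    (f : W →+ (β → ZMod 2)) (B : Finset β) (hB : ∀ y ∈ B, ∃ a, f a y ≠ 0) :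
    ∃ a, 2 * (B.filter fun y => f a y = 0).card ≤ B.card := by
  have hsum : ∑ a : W, 2 * (B.filter fun y => f a y = 0).card = ∑ _a : W, B.card := by
    have hcomm := Finset.sum_card_bipartiteAbove_eq_sum_card_bipartiteBelow
      (s := (Finset.univ : Finset W)) (t := B) (fun a y => f a y = 0)
    simp only [Finset.bipartiteAbove, Finset.bipartiteBelow] at hcomm
    rw [← Finset.mul_sum, hcomm, Finset.mul_sum,
      Finset.sum_congr rfl fun y hy => two_mul_card_apply_eq_zero f y (hB y hy)]
    simp [mul_comm]
  obtain ⟨a, -, ha⟩ := Finset.exists_le_of_sum_le Finset.univ_nonempty hsum.le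
  exact ⟨a, ha⟩

/-- A point outside a subspace is separated from it by a vector orthogonal to the subspace. -/
lemma exists_dotProduct_ne_zero_of_notMem {K : Type*} [Field K] {m : ℕ}
    (U : Submodule K (Fin m → K)) (y : Fin m → K) (hy : y ∉ U) :
    ∃ a : Fin m → K, (∀ z ∈ U, a ⬝ᵥ z = 0) ∧ a ⬝ᵥ y ≠ 0 := by
  obtain ⟨f, hfy, hf⟩ := Submodule.exists_le_ker_of_notMem hy
  have key : ∀ z, (fun i => f (Pi.single i 1)) ⬝ᵥ z = f z := by
    intro z
    rw [LinearMap.pi_apply_eq_sum_univ f z]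
    refine Finset.sum_congr rfl fun i _ => ?_
    have hi : (Pi.single i 1 : Fin m → K) = fun j => if i = j then 1 else 0 := by
      ext j
      simp [Pi.single_apply, eq_comm]
    rw [smul_eq_mul, ← hi, mul_comm]
  exact ⟨fun i => f (Pi.single i 1), fun z hz => (key z).trans (hf hz), by rwa [key]⟩

/-- For a coset `u + U₀` and a set `B` disjoint from it, some polynomial of degree at most one
is `1` on the coset and vanishes on at least half of `B`. -/
lemma exists_totalDegree_le_one_two_mul_card_le {m : ℕ} (u : Fin m → ZMod 2)
    (U₀ : Submodule (ZMod 2) (Fin m → ZMod 2)) (B : Finset (Fin m → ZMod 2))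
    (hB : ∀ x ∈ B, x - u ∉ U₀) :
    ∃ Q : MvPolynomial (Fin m) (ZMod 2), Q.totalDegree ≤ 1 ∧
      (∀ x, x - u ∈ U₀ → MvPolynomial.eval x Q = 1) ∧
      2 * (B.filter fun x => MvPolynomial.eval x Q ≠ 0).card ≤ B.card := by
  let W : AddSubgroup (Fin m → ZMod 2) :=
    { carrier := {a | ∀ z ∈ U₀, a ⬝ᵥ z = 0}
      zero_mem' := fun z _ => zero_dotProduct z
      add_mem' := fun ha hb z hz => by rw [add_dotProduct, ha z hz, hb z hz, add_zero]
      neg_mem' := fun ha z hz => by rw [neg_dotProduct, ha z hz, neg_zero] }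
  let f : W →+ ((Fin m → ZMod 2) → ZMod 2) :=
    { toFun := fun a x => (a : Fin m → ZMod 2) ⬝ᵥ (x - u)
      map_zero' := funext fun x => zero_dotProduct _
      map_add' := fun a b => funext fun x => add_dotProduct _ _ _ }
  obtain ⟨⟨a, haW⟩, ha⟩ := exists_two_mul_card_apply_eq_zero_le f B fun x hx => by
    obtain ⟨a, ha, hax⟩ := exists_dotProduct_ne_zero_of_notMem U₀ _ (hB x hx)
    exact ⟨⟨a, ha⟩, hax⟩
  let Q : MvPolynomial (Fin m) (ZMod 2) :=
    1 + ∑ i, MvPolynomial.C (a i) * (MvPolynomial.X i - MvPolynomial.C (u i))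
  have heval : ∀ x, MvPolynomial.eval x Q = 1 + a ⬝ᵥ (x - u) := fun x => by
    simp [Q, dotProduct]
  refine ⟨Q, ?_, fun x hx => ?_, ?_⟩
  · refine (MvPolynomial.totalDegree_add _ _).trans (max_le (by simp) ?_)
    refine MvPolynomial.totalDegree_finsetSum_le fun i _ => ?_
    refine (MvPolynomial.totalDegree_mul _ _).trans ?_
    rw [MvPolynomial.totalDegree_C, zero_add]
    refine (MvPolynomial.totalDegree_sub_C_le _ _).trans ?_
    rw [MvPolynomial.totalDegree_X]
  · rw [heval, haW _ hx, add_zero]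
  · have hiff : ∀ p : ZMod 2, 1 + p ≠ 0 ↔ p = 0 := by decide
    simp only [heval, hiff]
    exact ha

/-- The one-sided form of the approximation: the polynomial is `1` on the coset and is nonzero on
at most a `2⁻ᵗ` fraction of the space outside it. -/
lemma exists_totalDegree_le_card_mul_two_pow_le {m : ℕ} (t : ℕ) (u : Fin m → ZMod 2)
    (U₀ : Submodule (ZMod 2) (Fin m → ZMod 2)) :
    ∃ P : MvPolynomial (Fin m) (ZMod 2), P.totalDegree ≤ t ∧
      (∀ x, x - u ∈ U₀ → MvPolynomial.eval x P = 1) ∧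
      (Finset.univ.filter fun x => x - u ∉ U₀ ∧ MvPolynomial.eval x P ≠ 0).card * 2 ^ t ≤
        2 ^ m := by
  induction t with
  | zero =>
    refine ⟨1, by simp, by simp, ?_⟩
    rw [pow_zero, mul_one]
    exact (Finset.card_le_univ _).trans_eq (by simp [ZMod.card])
  | succ t ih =>
    obtain ⟨P, hdeg, hone, hcard⟩ := ih
    obtain ⟨Q, hQdeg, hQone, hQcard⟩ := exists_totalDegree_le_one_two_mul_card_le u U₀
      (Finset.univ.filter fun x => x - u ∉ U₀ ∧ MvPolynomial.eval x P ≠ 0)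
      fun x hx => (Finset.mem_filter.mp hx).2.1
    refine ⟨P * Q, (MvPolynomial.totalDegree_mul _ _).trans (add_le_add hdeg hQdeg),
      fun x hx => by rw [map_mul, hone x hx, hQone x hx, one_mul], ?_⟩
    rw [Finset.filter_filter] at hQcard
    simp only [map_mul, mul_ne_zero_iff, ← and_assoc] at hQcard hcard ⊢
    refine le_trans ?_ hcard
    rw [pow_succ', ← mul_assoc, mul_comm _ 2]
    exact Nat.mul_le_mul_right _ hQcard

theorem low_degree_approximation_of_affine_indicator (m t : ℕ)
    (A : Set (Fin m → ZMod 2)) (hA : IsAffineSubspace A) :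
    ∃ P : MvPolynomial (Fin m) (ZMod 2), P.totalDegree ≤ t ∧
      ((Finset.univ.filter fun x : Fin m → ZMod 2 =>
          MvPolynomial.eval x P ≠ (if x ∈ A then (1 : ZMod 2) else 0)).card : ℝ) ≤
        (2 : ℝ) ^ m / 2 ^ t ∧
      ∀ x ∈ A, MvPolynomial.eval x P = 1 := by
  obtain ⟨u, U₀, rfl⟩ := hA
  obtain ⟨P, hdeg, hone, hcard⟩ := exists_totalDegree_le_card_mul_two_pow_le t u U₀
  refine ⟨P, hdeg, ?_, hone⟩
  have hbad : (Finset.univ.filter fun x : Fin m → ZMod 2 => MvPolynomial.eval x P ≠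
      (if x ∈ {x | x - u ∈ U₀} then (1 : ZMod 2) else 0)) =
      Finset.univ.filter fun x => x - u ∉ U₀ ∧ MvPolynomial.eval x P ≠ 0 := by
    refine Finset.filter_congr fun x _ => ?_
    by_cases hx : x - u ∈ U₀
    · simp [hx, hone x hx]
    · simp [hx]
  rw [hbad, le_div_iff₀ (by positivity)]
  exact_mod_cast hcard
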